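/- Let (G,q) be a nondegenerate metric group. Then (∑_{g∈G} q(g))⁸ = |G|⁴; equivalently, the central charge of (G,q) is an 8th root of unity. -/

import Mathlib

/-- The bimultiplicative form associated to a quadratic form `q` on a group:
`b(g,h) = q(g*h) * q(g)⁻¹ * q(h)⁻¹`. -/
def metricForm {G : Type*} [Group G] (q : G → ℂˣ) (g h : G) : ℂˣ :=
  q (g * h) * (q g)⁻¹ * (q h)⁻¹

section QuaternionAction

variable {A M : Type*} [AddCommGroup A] [AddCommGroup M]

/-- Left multiplication by the integral quaternion `a + bi + cj + dk` on `A⁴ = ℍ(ℤ) ⊗ A`. -/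
def quaternionAct (a b c d : ℤ) (p : A × A × A × A) : A × A × A × A :=
  (a • p.1 - b • p.2.1 - c • p.2.2.1 - d • p.2.2.2,
    b • p.1 + a • p.2.1 - d • p.2.2.1 + c • p.2.2.2,
    c • p.1 + d • p.2.1 + a • p.2.2.1 - b • p.2.2.2,
    d • p.1 - c • p.2.1 + b • p.2.2.1 + a • p.2.2.2)

theorem quaternionAct_conj (a b c d : ℤ) (p : A × A × A × A) :
    quaternionAct a (-b) (-c) (-d) (quaternionAct a b c d p) =
      (a ^ 2 + b ^ 2 + c ^ 2 + d ^ 2) • p := by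
  obtain ⟨x, y, z, w⟩ := p
  simp only [quaternionAct, Prod.smul_mk, Prod.mk.injEq]
  refine ⟨?_, ?_, ?_, ?_⟩ <;> module

/-- The orthogonal sum of four copies of a quadratic map. -/
def quadFour (Q : QuadraticMap ℤ A M) (p : A × A × A × A) : M :=
  Q p.1 + Q p.2.1 + Q p.2.2.1 + Q p.2.2.2

theorem QuadraticMap.map_sum_four_smul (Q : QuadraticMap ℤ A M) (a b c d : ℤ) (x y z w : A) :
    Q (a • x + b • y + c • z + d • w) =
      (a * a) • Q x + (b * b) • Q y + (c * c) • Q z + (d * d) • Q w +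
        (a * b) • polar Q x y + (a * c) • polar Q x z + (a * d) • polar Q x w +
        (b * c) • polar Q y z + (b * d) • polar Q y w + (c * d) • polar Q z w := by
  rw [QuadraticMap.map_add Q, QuadraticMap.map_add Q, QuadraticMap.map_add Q, polar_add_left,
    polar_add_left, polar_add_left]
  simp only [QuadraticMap.map_smul, polar_smul_left, polar_smul_right]
  module

theorem quadFour_quaternionAct (Q : QuadraticMap ℤ A M) (a b c d : ℤ) (p : A × A × A × A) :
    quadFour Q (quaternionAct a b c d p) = (a ^ 2 + b ^ 2 + c ^ 2 + d ^ 2) • quadFour Q p := by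
  obtain ⟨x, y, z, w⟩ := p
  simp only [quadFour, quaternionAct, sub_eq_add_neg, ← neg_smul, QuadraticMap.map_sum_four_smul]
  module

theorem two_mul_card_smul_quadraticMap [Fintype A] (Q : QuadraticMap ℤ A M) (x : A) :
    (2 * Fintype.card A : ℤ) • Q x = 0 := by
  have h : (Fintype.card A : ℤ) • QuadraticMap.polar Q x x = 0 := by
    rw [← QuadraticMap.polar_smul_left, natCast_zsmul, card_nsmul_eq_zero,
      QuadraticMap.polar_zero_left]
  rw [QuadraticMap.polar_self, ← Nat.cast_smul_eq_nsmul ℤ, smul_smul] at h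
  rw [mul_comm]
  exact_mod_cast h

/-- Four copies of a quadratic map on a finite group are isometric to four copies of its
negative: by Lagrange's theorem there is a quaternion of norm `2 * |A| - 1`. -/
theorem exists_equiv_quadFour_eq_neg [Fintype A] (Q : QuadraticMap ℤ A M) :
    ∃ e : (A × A × A × A) ≃ (A × A × A × A), ∀ p, quadFour Q (e p) = -quadFour Q p := by
  obtain ⟨a, b, c, d, h⟩ := Nat.sum_four_squares (2 * Fintype.card A - 1)
  have hpos : 0 < Fintype.card A := Fintype.card_pos
  have hm : (a ^ 2 + b ^ 2 + c ^ 2 + d ^ 2 : ℤ) = 2 * Fintype.card A - 1 := by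
    zify [show 1 ≤ 2 * Fintype.card A by omega] at h
    exact h
  have hinj : Function.Injective (quaternionAct (A := A) a b c d) := by
    intro p p' hp
    have hneg (r : A × A × A × A) :
        quaternionAct (a : ℤ) (-b) (-c) (-d) (quaternionAct a b c d r) = -r := by
      have hr (x : A) : (2 * Fintype.card A - 1 : ℤ) • x = -x := by
        rw [sub_smul, mul_smul, natCast_zsmul, card_nsmul_eq_zero]
        simp
      rw [quaternionAct_conj, hm]
      ext <;> simp [hr]
    exact neg_injective (by rw [← hneg, ← hneg, hp])
  refine ⟨Equiv.ofBijective _ (Finite.injective_iff_bijective.mp hinj), fun p => ?_⟩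
  rw [Equiv.ofBijective_apply, quadFour_quaternionAct, hm, sub_smul, one_smul]
  simp only [quadFour, smul_add, two_mul_card_smul_quadraticMap]
  simp

end QuaternionAction

theorem sum_pow_four {ι R : Type*} [Fintype ι] [CommSemiring R] (f : ι → R) :
    (∑ i, f i) ^ 4 = ∑ p : ι × ι × ι × ι, f p.1 * f p.2.1 * f p.2.2.1 * f p.2.2.2 := by
  simp only [Fintype.sum_prod_type, ← Finset.mul_sum, ← Finset.sum_mul]
  ring

section MetricGroup

variable {G : Type*} [CommGroup G] {q : G → ℂˣ}

theorem metricForm_comm (q : G → ℂˣ) (g h : G) : metricForm q g h = metricForm q h g := by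
  rw [metricForm, metricForm, mul_comm g h, mul_right_comm]

theorem map_mul_eq_metricForm (q : G → ℂˣ) (g h : G) :
    q (g * h) = q g * q h * metricForm q g h := by
  rw [metricForm, mul_assoc (q (g * h)), ← mul_inv, mul_comm (q g * q h), inv_mul_cancel_right]

/-- The character `h ↦ b(h, g)` of a metric group. -/
def metricFormHom
    (hq2 : ∀ g₁ g₂ h : G, metricForm q (g₁ * g₂) h = metricForm q g₁ h * metricForm q g₂ h)
    (g : G) : G →* ℂˣ :=
  MonoidHom.mk' (fun h => metricForm q h g) fun h₁ h₂ => hq2 h₁ h₂ g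

theorem metricForm_zpow_left
    (hq2 : ∀ g₁ g₂ h : G, metricForm q (g₁ * g₂) h = metricForm q g₁ h * metricForm q g₂ h)
    (g h : G) (n : ℤ) : metricForm q (g ^ n) h = metricForm q g h ^ n :=
  map_zpow (metricFormHom hq2 h) g n

theorem map_one_of_metricForm_mul
    (hq2 : ∀ g₁ g₂ h : G, metricForm q (g₁ * g₂) h = metricForm q g₁ h * metricForm q g₂ h) :
    q 1 = 1 := by
  have h : metricForm q 1 1 = 1 := map_one (metricFormHom hq2 1)
  simpa [metricForm] using h

theorem metricForm_self (hq1 : ∀ g : G, q g⁻¹ = q g)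
    (hq2 : ∀ g₁ g₂ h : G, metricForm q (g₁ * g₂) h = metricForm q g₁ h * metricForm q g₂ h)
    (g : G) : metricForm q g g = q g ^ 2 := by
  have h : metricForm q g⁻¹ g = (metricForm q g g)⁻¹ := map_inv (metricFormHom hq2 g) g
  rw [metricForm, inv_mul_cancel, map_one_of_metricForm_mul hq2, hq1] at h
  rw [← inv_inj, ← h]
  simp [sq]

theorem map_zpow_eq_zpow_sq (hq1 : ∀ g : G, q g⁻¹ = q g)
    (hq2 : ∀ g₁ g₂ h : G, metricForm q (g₁ * g₂) h = metricForm q g₁ h * metricForm q g₂ h)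
    (g : G) (n : ℤ) : q (g ^ n) = q g ^ (n * n) := by
  have hnat (n : ℕ) : q (g ^ n) = q g ^ (n * n) := by
    induction n with
    | zero => simpa using map_one_of_metricForm_mul hq2
    | succ n ih =>
      have h := metricForm_zpow_left hq2 g g n
      rw [zpow_natCast, zpow_natCast, metricForm_self hq1 hq2] at h
      rw [pow_succ, map_mul_eq_metricForm q, ih, h, ← pow_mul, ← pow_succ, ← pow_add]
      ring_nf
  obtain ⟨k, rfl | rfl⟩ := n.eq_nat_or_neg
  · exact_mod_cast hnat k
  · rw [zpow_neg, hq1, neg_mul_neg]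
    exact_mod_cast hnat k

theorem polar_ofMul_comp_toMul (q : G → ℂˣ) (x y : Additive G) :
    QuadraticMap.polar (fun x : Additive G => Additive.ofMul (q x.toMul)) x y =
      Additive.ofMul (metricForm q x.toMul y.toMul) := by
  simp [QuadraticMap.polar, metricForm, sub_eq_add_neg]

/-- A metric group as an integral quadratic map, written additively. -/
def metricQuadraticMap (hq1 : ∀ g : G, q g⁻¹ = q g)
    (hq2 : ∀ g₁ g₂ h : G, metricForm q (g₁ * g₂) h = metricForm q g₁ h * metricForm q g₂ h) :
    QuadraticMap ℤ (Additive G) (Additive ℂˣ) :=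
  QuadraticMap.ofPolar (fun x => Additive.ofMul (q x.toMul))
    (fun n x => congrArg Additive.ofMul (map_zpow_eq_zpow_sq hq1 hq2 x.toMul n))
    (fun x y z => by
      simp only [polar_ofMul_comp_toMul]
      exact congrArg Additive.ofMul (hq2 x.toMul y.toMul z.toMul))
    (fun n x y => by
      simp only [polar_ofMul_comp_toMul]
      exact congrArg Additive.ofMul (metricForm_zpow_left hq2 x.toMul y.toMul n))

variable [Fintype G]

theorem sum_pow_four_eq_sum_inv_pow_four (hq1 : ∀ g : G, q g⁻¹ = q g)
    (hq2 : ∀ g₁ g₂ h : G, metricForm q (g₁ * g₂) h = metricForm q g₁ h * metricForm q g₂ h) :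
    (∑ g : G, (q g : ℂ)) ^ 4 = (∑ g : G, ((q g)⁻¹ : ℂˣ) : ℂ) ^ 4 := by
  obtain ⟨e, he⟩ := exists_equiv_quadFour_eq_neg (metricQuadraticMap hq1 hq2)
  rw [sum_pow_four, sum_pow_four]
  refine (Equiv.sum_comp (ι := G × G × G × G) (κ := G × G × G × G) e _).symm.trans ?_
  refine Finset.sum_congr rfl fun p _ => ?_
  have h : q (e p).1 * q (e p).2.1 * q (e p).2.2.1 * q (e p).2.2.2 =
      (q p.1 * q p.2.1 * q p.2.2.1 * q p.2.2.2)⁻¹ := congrArg Additive.toMul (he p)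
  rw [mul_inv, mul_inv, mul_inv] at h
  exact_mod_cast congrArg Units.val h

theorem sum_mul_sum_inv_eq_card
    (hq2 : ∀ g₁ g₂ h : G, metricForm q (g₁ * g₂) h = metricForm q g₁ h * metricForm q g₂ h)
    (hnd : ∀ g : G, (∀ h : G, metricForm q g h = 1) → g = 1) :
    (∑ g : G, (q g : ℂ)) * (∑ g : G, ((q g)⁻¹ : ℂˣ) : ℂ) = Fintype.card G := by
  classical
  have hchar (k : G) :
      ∑ h : G, (metricForm q h k : ℂ) = if k = 1 then (Fintype.card G : ℂ) else 0 := by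
    have hsum := sum_hom_units ((Units.coeHom ℂ).comp (metricFormHom hq2 k))
    have hiff : (Units.coeHom ℂ).comp (metricFormHom hq2 k) = 1 ↔ k = 1 := by
      constructor
      · refine fun hk => hnd k fun h => ?_
        rw [metricForm_comm]
        exact Units.ext (DFunLike.congr_fun hk h)
      · rintro rfl
        ext h
        rw [MonoidHom.comp_apply]
        simp [metricFormHom, metricForm, map_one_of_metricForm_mul hq2]
    simp only [hiff] at hsum
    exact_mod_cast hsum
  calc
    _ = ∑ h : G, ∑ g : G, (q g : ℂ) * ((q h)⁻¹ : ℂˣ) := by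
      rw [Finset.sum_mul_sum, Finset.sum_comm]
    _ = ∑ h : G, ∑ k : G, (q k : ℂ) * metricForm q h k := by
      refine Finset.sum_congr rfl fun h _ => ?_
      rw [← Equiv.sum_comp (Equiv.mulLeft h)]
      refine Finset.sum_congr rfl fun k _ => ?_
      rw [Equiv.coe_mulLeft, map_mul_eq_metricForm q, ← Units.val_mul, ← Units.val_mul]
      congr 1
      rw [mul_right_comm, mul_right_comm (q h), mul_inv_cancel, one_mul]
    _ = Fintype.card G := by
      rw [Finset.sum_comm]
      simp [← Finset.mul_sum, hchar, map_one_of_metricForm_mul hq2]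

end MetricGroup

/-- For a nondegenerate metric group `(G,q)` one has
`(∑ q(g))⁸ = |G|⁴`; equivalently, the central charge of `(G,q)` is an 8th root of
unity. -/
theorem gauss_sum_eighth_power
    {G : Type*} [CommGroup G] [Fintype G] (q : G → ℂˣ)
    (hq1 : ∀ g : G, q g⁻¹ = q g)
    (hq2 : ∀ g₁ g₂ h : G, metricForm q (g₁ * g₂) h = metricForm q g₁ h * metricForm q g₂ h)
    (hnd : ∀ g : G, (∀ h : G, metricForm q g h = 1) → g = 1) :
    (∑ g : G, (q g : ℂ)) ^ 8 = (Fintype.card G : ℂ) ^ 4 := by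
  rw [← sum_mul_sum_inv_eq_card hq2 hnd, mul_pow, ← sum_pow_four_eq_sum_inv_pow_four hq1 hq2]
  ring
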